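/- Let b>0, p≥2, ε>0 and β₁ ≥ 1/(p−1). Set f(s):=|s|^{β₁−1}s and g(s):=(p−1)|s|^{p−2}+ε. If u₀∈C((−b,b)) satisfies inf_{x∈(−b,b)} u₀(x) > −∞, then there is no viscosity solution u:(−b,b)×[0,∞)→ℝ of the initial value problem u_t − f(g(u_x)u_{xx}) = 0 in Q (i.e. the p-Laplace type heat equation u_t = |Δ_p u + εΔu|^{β₁−1}(Δ_p u + εΔu)), with the singular Dirichlet condition lim_{x→±b}u(x,t)=∞ for t>0, and initial datum u₀. -/

import Mathlib

open Filter Set Topology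

noncomputable section

/-- The parabolic cylinder `Q = (-b,b) × (0,∞)`. -/
def Qset (b : ℝ) : Set (ℝ × ℝ) := Ioo (-b) b ×ˢ Ioi (0:ℝ)

/-- The cylinder `Q₀ = (-b,b) × [0,∞)`. -/
def Q0set (b : ℝ) : Set (ℝ × ℝ) := Ioo (-b) b ×ˢ Ici (0:ℝ)

/-- Partial derivative in time. -/
def pT (φ : ℝ × ℝ → ℝ) (p : ℝ × ℝ) : ℝ := deriv (fun t => φ (p.1, t)) p.2

/-- Partial derivative in space. -/
def pX (φ : ℝ × ℝ → ℝ) (p : ℝ × ℝ) : ℝ := deriv (fun x => φ (x, p.2)) p.1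

/-- Second partial derivative in space. -/
def pXX (φ : ℝ × ℝ → ℝ) (p : ℝ × ℝ) : ℝ := deriv (fun x => pX φ (x, p.2)) p.1

/-- (A1): `f` is continuous, strictly increasing, `f 0 = 0`, `f(s) → ±∞` as `s → ±∞`. -/
def A1 (f : ℝ → ℝ) : Prop :=
  Continuous f ∧ StrictMono f ∧ f 0 = 0 ∧ Tendsto f atTop atTop ∧ Tendsto f atBot atBot

/-- (A2) with exponent `α`: `g` is continuous, positive, and `|s|^α g(s)` has positive
limits as `s → ±∞`. -/
def A2 (g : ℝ → ℝ) (α : ℝ) : Prop :=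
  Continuous g ∧ (∀ s, 0 < g s) ∧
  ∃ Cgp Cgm : ℝ, 0 < Cgp ∧ 0 < Cgm ∧
    Tendsto (fun s => |s| ^ α * g s) atTop (𝓝 Cgp) ∧
    Tendsto (fun s => |s| ^ α * g s) atBot (𝓝 Cgm)

/-- (A3) with exponent `β > 0`: `|s|^(-β) f s → ±C_{f±}` as `s → ±∞`. -/
def A3 (f : ℝ → ℝ) (β : ℝ) : Prop :=
  0 < β ∧ ∃ Cfp Cfm : ℝ, 0 < Cfp ∧ 0 < Cfm ∧
    Tendsto (fun s => |s| ^ (-β) * f s) atTop (𝓝 Cfp) ∧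
    Tendsto (fun s => |s| ^ (-β) * f s) atBot (𝓝 (-Cfm))

/-- (B1): `u₀ ∈ C([-b,b])`. -/
def B1 (b : ℝ) (u0 : ℝ → ℝ) : Prop := ContinuousOn u0 (Icc (-b) b)

/-- (B2): `u₀ ∈ C((-b,b))`, diverging to `∞` at `±b` with polynomial rate bound. -/
def B2 (b : ℝ) (u0 : ℝ → ℝ) : Prop :=
  ContinuousOn u0 (Ioo (-b) b) ∧
  Tendsto u0 (𝓝[<] b) atTop ∧ Tendsto u0 (𝓝[>] (-b)) atTop ∧
  ∃ γ : ℝ, 0 < γ ∧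
    (∃ C : ℝ, ∀ᶠ x in 𝓝[<] b, u0 x * (b - x) ^ γ ≤ C) ∧
    (∃ C : ℝ, ∀ᶠ x in 𝓝[>] (-b), u0 x * (b + x) ^ γ ≤ C)

/-- `ψ_γ(s) = s^(-γ)` for `γ > 0` and `ψ₀(s) = -log s`. -/
def psi (γ : ℝ) (s : ℝ) : ℝ := if 0 < γ then s ^ (-γ) else -Real.log s

/-- (B3): `u₀ ∈ C((-b,b))` behaves like `D₊ ψ_{γ₊}(b-x)` near `b` and like
`D₋ ψ_{γ₋}(b+x)` near `-b`, up to constants. -/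
def B3 (b : ℝ) (u0 : ℝ → ℝ) (γp γm Dp Dm : ℝ) : Prop :=
  ContinuousOn u0 (Ioo (-b) b) ∧ 0 ≤ γp ∧ 0 ≤ γm ∧ 0 < Dp ∧ 0 < Dm ∧
  ∃ Cp Cm : ℝ,
    Tendsto (fun x => u0 x - Dp * psi γp (b - x)) (𝓝[<] b) (𝓝 Cp) ∧
    Tendsto (fun x => u0 x - Dm * psi γm (b + x)) (𝓝[>] (-b)) (𝓝 Cm)

/-- Viscosity sub-solution of `u_t - f(g(u_x) u_{xx}) = 0` in `Q`. -/
def IsSubSol (b : ℝ) (f g : ℝ → ℝ) (u : ℝ × ℝ → ℝ) : Prop :=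
  UpperSemicontinuousOn u (Q0set b) ∧
  ∀ φ : ℝ × ℝ → ℝ, ContDiffOn ℝ 2 φ (Qset b) →
    ∀ p ∈ Qset b, IsLocalMaxOn (fun q => u q - φ q) (Qset b) p →
      pT φ p - f (g (pX φ p) * pXX φ p) ≤ 0

/-- The singular Dirichlet boundary condition at time `t`:
`v(x,t) → ∞` as `x → ±b`. -/
def SingularBC (b : ℝ) (v : ℝ × ℝ → ℝ) (t : ℝ) : Prop :=
  Tendsto (fun x => v (x, t)) (𝓝[<] b) atTop ∧
  Tendsto (fun x => v (x, t)) (𝓝[>] (-b)) atTop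

/-- Viscosity super-solution of `u_t - f(g(u_x) u_{xx}) = 0` in `Q` together with the
singular Dirichlet boundary condition. -/
def IsSuperSol (b : ℝ) (f g : ℝ → ℝ) (v : ℝ × ℝ → ℝ) : Prop :=
  LowerSemicontinuousOn v (Q0set b) ∧
  (∀ φ : ℝ × ℝ → ℝ, ContDiffOn ℝ 2 φ (Qset b) →
    ∀ p ∈ Qset b, IsLocalMinOn (fun q => v q - φ q) (Qset b) p →
      0 ≤ pT φ p - f (g (pX φ p) * pXX φ p)) ∧
  (∀ t : ℝ, 0 < t → SingularBC b v t)

/-- Upper semicontinuous envelope relative to `Q₀`. -/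
def uscEnv (b : ℝ) (u : ℝ × ℝ → ℝ) (p : ℝ × ℝ) : ℝ := limsup u (𝓝[Q0set b] p)

/-- Lower semicontinuous envelope relative to `Q₀`. -/
def lscEnv (b : ℝ) (u : ℝ × ℝ → ℝ) (p : ℝ × ℝ) : ℝ := liminf u (𝓝[Q0set b] p)

/-- Viscosity solution of the initial value problem: `u*` is a sub-solution, `u_*` is a
super-solution (including the singular Dirichlet condition), and both envelopes agree
with `u₀` at `t = 0`. -/
def IsVSol (b : ℝ) (f g : ℝ → ℝ) (u0 : ℝ → ℝ) (u : ℝ × ℝ → ℝ) : Prop :=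
  IsSubSol b f g (uscEnv b u) ∧ IsSuperSol b f g (lscEnv b u) ∧
  ∀ x ∈ Ioo (-b) b, uscEnv b u (x, 0) = u0 x ∧ lscEnv b u (x, 0) = u0 x

/-- The elliptic part `f(g(a) z)`. -/
def HH (p ε β a z : ℝ) : ℝ :=
  |((p - 1) * |a| ^ (p - 2) + ε) * z| ^ (β - 1) * (((p - 1) * |a| ^ (p - 2) + ε) * z)

structure SupS (b p ε β : ℝ) (v : ℝ × ℝ → ℝ) : Prop where
  lsc : ∀ q ∈ Qset b, LowerSemicontinuousAt v q
  visc : ∀ φ : ℝ × ℝ → ℝ, ContDiff ℝ 2 φ →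
    ∀ q ∈ Qset b, IsLocalMin (fun q => v q - φ q) q →
      HH p ε β (pX φ q) (pXX φ q) ≤ pT φ q
  bc : ∀ t : ℝ, 0 < t → Tendsto (fun x => v (x, t)) (𝓝[<] b) atTop

lemma isOpen_Qset (b : ℝ) : IsOpen (Qset b) := isOpen_Ioo.prod isOpen_Ioi

lemma HH_zero (p ε β a : ℝ) : HH p ε β a 0 = 0 := by simp [HH]

lemma sgnpow {β s : ℝ} (hs : 0 < s) : |s| ^ (β - 1) * s = s ^ β := by
  rw [abs_of_pos hs, Real.rpow_sub_one hs.ne']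
  field_simp

lemma HH_lower {p ε β a z a0 : ℝ} (hp : 2 ≤ p) (hε : 0 < ε) (hβ : 0 < β) (ha0 : 0 < a0)
    (ha : a0 ≤ |a|) (hz : 0 < z) : (a0 ^ (p - 2) * z) ^ β ≤ HH p ε β a z := by
  have h1 : a0 ^ (p - 2) ≤ |a| ^ (p - 2) :=
    Real.rpow_le_rpow ha0.le ha (by linarith)
  have h0 : 0 < a0 ^ (p - 2) := Real.rpow_pos_of_pos ha0 _
  have h2 : a0 ^ (p - 2) ≤ (p - 1) * |a| ^ (p - 2) + ε := by nlinarith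
  have h3 : 0 < ((p - 1) * |a| ^ (p - 2) + ε) * z := by
    apply mul_pos _ hz; linarith
  rw [HH, sgnpow h3]
  apply Real.rpow_le_rpow (by positivity) _ hβ.le
  gcongr

lemma HH_neg {p ε β a z a1 : ℝ} (hp : 2 ≤ p) (hε : 0 < ε) (hβ : 0 < β)
    (ha : |a| ≤ a1) (hz : 0 < z) :
    -((((p - 1) * a1 ^ (p - 2) + ε) * z) ^ β) ≤ HH p ε β a (-z) := by
  have h1 : |a| ^ (p - 2) ≤ a1 ^ (p - 2) :=
    Real.rpow_le_rpow (abs_nonneg _) ha (by linarith)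
  have h0 : 0 ≤ |a| ^ (p - 2) := by positivity
  have h3 : 0 < ((p - 1) * |a| ^ (p - 2) + ε) * z := by
    apply mul_pos _ hz; nlinarith
  have : HH p ε β a (-z) = -((((p - 1) * |a| ^ (p - 2) + ε) * z) ^ β) := by
    rw [← sgnpow h3, HH, mul_neg, abs_neg]; ring
  rw [this]
  apply neg_le_neg
  apply Real.rpow_le_rpow h3.le _ hβ.le
  have : 0 ≤ p - 1 := by linarith
  gcongr

/-- Comparison lemma. -/
lemma comp {b p ε β : ℝ} {v : ℝ × ℝ → ℝ} (hv : SupS b p ε β v) {x1 x2 s T : ℝ}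
    (h1 : -b ≤ x1) (h2 : x2 ≤ b) (hs : 0 ≤ s)
    (W : ℝ × ℝ → ℝ) (Wt Wx Wxx : ℝ → ℝ → ℝ) (hW : ContDiff ℝ 2 W)
    (hWt : ∀ x t, HasDerivAt (fun t => W (x, t)) (Wt x t) t)
    (hWx : ∀ x t, HasDerivAt (fun x => W (x, t)) (Wx x t) x)
    (hWxx : ∀ x t, HasDerivAt (fun x => Wx x t) (Wxx x t) x)
    (hint : ∀ x ∈ Ioo x1 x2, ∀ t ∈ Ioo s T, v (x, t) < W (x, t) →
      Wt x t ≤ HH p ε β (Wx x t) (Wxx x t))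
    (hbd : ∀ x ∈ Icc x1 x2, ∀ t ∈ Icc s T, (x = x1 ∨ x = x2 ∨ t = s) → ∀ η > 0,
      ∀ᶠ q in 𝓝 (x, t), q.1 ∈ Ioo x1 x2 → q.2 ∈ Ioo s T → W q - η ≤ v q) :
    ∀ x ∈ Ioo x1 x2, ∀ t ∈ Ioo s T, W (x, t) ≤ v (x, t) := by
  intro x hx t ht
  by_contra hcon
  push Not at hcon
  -- penalization
  have hTt : 0 < T - t := by linarith [ht.2]
  obtain ⟨κ, hκ, hκ2⟩ : ∃ κ > 0, v (x, t) - W (x, t) + κ * (T - t)⁻¹ < 0 := by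
    refine ⟨(W (x, t) - v (x, t)) / 2 * (T - t), by nlinarith, ?_⟩
    rw [mul_assoc, mul_inv_cancel₀ hTt.ne']; linarith
  set O : Set (ℝ × ℝ) := Ioo x1 x2 ×ˢ Ioo s T with hO
  have hOo : IsOpen O := isOpen_Ioo.prod isOpen_Ioo
  have hOQ : O ⊆ Qset b := by
    rintro ⟨y, r⟩ ⟨hy, hr⟩
    exact ⟨⟨lt_of_le_of_lt h1 hy.1, lt_of_lt_of_le hy.2 h2⟩, lt_of_le_of_lt hs hr.1⟩
  set Φ : ℝ × ℝ → ℝ := fun q => v q - W q + κ * (T - q.2)⁻¹ with hΦ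
  set μ := -Φ (x, t) with hμ
  have hμ0 : 0 < μ := by simp only [hμ, hΦ]; linarith
  have hWc : Continuous W := hW.continuous
  have hΦl : ∀ q ∈ O, LowerSemicontinuousAt Φ q := by
    intro q hq
    have a1 : LowerSemicontinuousAt (fun q : ℝ × ℝ => -W q + κ * (T - q.2)⁻¹) q := by
      apply ContinuousAt.lowerSemicontinuousAt
      have : T - q.2 ≠ 0 := by have := hq.2.2; intro h; linarith
      have := hWc.continuousAt (x := q)
      fun_prop (disch := assumption)
    have := (hv.lsc q (hOQ hq)).add a1
    have e : Φ = fun z => v z + (-W z + κ * (T - z.2)⁻¹) := by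
      funext z; simp only [hΦ]; ring
    rw [e]; exact this
  set S : Set (ℝ × ℝ) := {q | q ∈ O ∧ Φ q ≤ -μ} with hS
  have hSO : S ⊆ O := fun q hq => hq.1
  have hxS : (x, t) ∈ S := ⟨⟨hx, ht⟩, by simp [hμ]⟩
  have hSB : S ⊆ Icc x1 x2 ×ˢ Icc s T := fun q hq =>
    ⟨Ioo_subset_Icc_self hq.1.1, Ioo_subset_Icc_self hq.1.2⟩
  have hBc : IsCompact (Icc x1 x2 ×ˢ Icc s T) := isCompact_Icc.prod isCompact_Icc
  have hSclosed : IsClosed S := by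
    apply isClosed_of_closure_subset
    intro q hq
    have hqB : q ∈ Icc x1 x2 ×ˢ Icc s T := closure_minimal hSB hBc.isClosed hq
    have hfreq : ∃ᶠ y in 𝓝 q, y ∈ S := mem_closure_iff_frequently.1 hq
    by_cases hqO : q ∈ O
    · refine ⟨hqO, ?_⟩
      by_contra hlt
      push Not at hlt
      have := hΦl q hqO _ hlt
      obtain ⟨y, hy1, hy2⟩ := (hfreq.and_eventually this).exists
      exact absurd hy1.2 (not_le.2 hy2)
    · exfalso
      by_cases hbq : q.1 = x1 ∨ q.1 = x2 ∨ q.2 = s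
      · have := hbd q.1 hqB.1 q.2 hqB.2 hbq (μ / 2) (by linarith)
        obtain ⟨y, hy1, hy2⟩ := (hfreq.and_eventually this).exists
        have h3 := hy2 hy1.1.1 hy1.1.2
        have h4 := hy1.2
        have h5 : 0 < κ * (T - y.2)⁻¹ := by
          have := hy1.1.2.2
          have : 0 < T - y.2 := by linarith
          positivity
        simp only [hΦ] at h4
        linarith
      · push Not at hbq
        have hq1 : q.1 ∈ Ioo x1 x2 :=
          ⟨lt_of_le_of_ne hqB.1.1 (Ne.symm hbq.1), lt_of_le_of_ne hqB.1.2 hbq.2.1⟩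
        have hq2s : s < q.2 := lt_of_le_of_ne hqB.2.1 (Ne.symm hbq.2.2)
        have hq2 : q.2 = T := by
          by_contra hne
          exact hqO ⟨hq1, hq2s, lt_of_le_of_ne hqB.2.2 hne⟩
        have hqQ : q ∈ Qset b :=
          ⟨⟨lt_of_le_of_lt h1 hq1.1, lt_of_lt_of_le hq1.2 h2⟩, lt_of_le_of_lt hs hq2s⟩
        have e1 := hv.lsc q hqQ (v q - 1) (by linarith)
        have e2 : ∀ᶠ y in 𝓝 q, W y < W q + 1 :=
          hWc.continuousAt.eventually_lt continuousAt_const (by linarith)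
        set N := |v q| + |W q| + 2 with hN
        have hN0 : 0 < N := by positivity
        have e3 : ∀ᶠ y : ℝ × ℝ in 𝓝 q, T - y.2 < κ / N := by
          have : ContinuousAt (fun y : ℝ × ℝ => T - y.2) q := by fun_prop
          apply this.eventually_lt continuousAt_const
          rw [hq2]; simp; positivity
        obtain ⟨y, hy1, hy2, hy3, hy4⟩ :=
          (hfreq.and_eventually (e1.and (e2.and e3))).exists
        have h4 := hy1.2
        have h6 := hy1.1.2.2
        have h7 : 0 < T - y.2 := by linarith
        have h5 : N < κ * (T - y.2)⁻¹ := by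
          rw [← div_eq_mul_inv, lt_div_iff₀ h7]
          rw [lt_div_iff₀ hN0] at hy4
          linarith
        simp only [hΦ] at h4
        have := neg_abs_le (v q)
        have := le_abs_self (W q)
        linarith
  have hScomp : IsCompact S := hBc.of_isClosed_subset hSclosed hSB
  obtain ⟨q, hqS, hqmin⟩ := LowerSemicontinuousOn.exists_isMinOn (f := Φ) ⟨_, hxS⟩ hScomp
    (fun y hy => (hΦl y (hSO hy)).lowerSemicontinuousWithinAt _)
  have hqO := hSO hqS
  have hminO : ∀ y ∈ O, Φ q ≤ Φ y := by
    intro y hy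
    by_cases hyS : y ∈ S
    · exact hqmin hyS
    · have : ¬ Φ y ≤ -μ := fun h => hyS ⟨hy, h⟩
      push Not at this
      linarith [hqS.2]
  set τ := T - q.2 with hτ
  have hτ0 : 0 < τ := by have := hqO.2.2; simp only [hτ]; linarith
  -- test function
  set φ : ℝ × ℝ → ℝ := fun y =>
    W y - κ * (τ⁻¹ + (y.2 - q.2) * (τ⁻¹) ^ 2 + (y.2 - q.2) ^ 2 * (2 * τ⁻¹ ^ 3)) with hφ
  have hφc : ContDiff ℝ 2 φ := by
    simp only [hφ]; fun_prop
  have hloc : IsLocalMin (fun y => v y - φ y) q := by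
    have e2 : ∀ᶠ y : ℝ × ℝ in 𝓝 q, τ / 2 < T - y.2 := by
      have : ContinuousAt (fun y : ℝ × ℝ => T - y.2) q := by fun_prop
      exact continuousAt_const.eventually_lt this (by simp only [← hτ]; linarith)
    filter_upwards [hOo.mem_nhds hqO, e2] with y hy hy2
    have h3 := hminO y hy
    simp only [hΦ] at h3
    simp only [hφ]
    have key : (T - y.2)⁻¹ ≤
        τ⁻¹ + (y.2 - q.2) * (τ⁻¹) ^ 2 + (y.2 - q.2) ^ 2 * (2 * τ⁻¹ ^ 3) := by
      have hd : T - y.2 = τ - (y.2 - q.2) := by simp only [hτ]; ring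
      rw [hd] at hy2 ⊢
      set d := y.2 - q.2
      have hpos : 0 < τ - d := by linarith
      have : τ⁻¹ + d * (τ⁻¹) ^ 2 + d ^ 2 * (2 * τ⁻¹ ^ 3) - (τ - d)⁻¹
          = d ^ 2 * (τ - 2 * d) / (τ ^ 3 * (τ - d)) := by
        field_simp; ring
      have h5 : 0 ≤ d ^ 2 * (τ - 2 * d) / (τ ^ 3 * (τ - d)) := by
        apply div_nonneg _ (by positivity)
        apply mul_nonneg (sq_nonneg _); linarith
      linarith
    have h4 := mul_le_mul_of_nonneg_left key hκ.le
    simp only [sub_self, zero_mul, add_zero, ne_eq, OfNat.ofNat_ne_zero, not_false_eq_true,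
      zero_pow]
    simp only [← hτ] at h3
    linarith
  have hfin := hv.visc φ hφc q (hOQ hqO) hloc
  have dT : pT φ q = Wt q.1 q.2 - κ * τ⁻¹ ^ 2 := by
    apply HasDerivAt.deriv
    simp only [hφ]
    have a1 : HasDerivAt (fun r : ℝ => r - q.2) 1 q.2 := (hasDerivAt_id q.2).sub_const _
    have a2 := ((((a1.mul_const (τ⁻¹ ^ 2)).const_add τ⁻¹).add
      ((a1.pow 2).mul_const (2 * τ⁻¹ ^ 3))).const_mul κ)
    refine ((hWt q.1 q.2).sub a2).congr_deriv ?_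
    simp
  have dX : ∀ y, pX φ (y, q.2) = Wx y q.2 := by
    intro y
    apply HasDerivAt.deriv
    simp only [hφ]
    exact (hWx y q.2).sub_const _
  have dXX : pXX φ q = Wxx q.1 q.2 := by
    apply HasDerivAt.deriv
    simp only [dX]
    exact hWxx _ _
  have hlt : v (q.1, q.2) < W (q.1, q.2) := by
    have h4 := hqS.2
    have h5 : 0 < κ * τ⁻¹ := by positivity
    simp only [hΦ, ← hτ] at h4
    show v q < W q
    linarith
  have h8 := hint q.1 hqO.1 q.2 hqO.2 hlt
  rw [dT, dXX, show q = (q.1, q.2) from rfl, dX] at hfin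
  have : 0 < κ * τ⁻¹ ^ 2 := by positivity
  linarith

lemma bd_of_bound {v W : ℝ × ℝ → ℝ} {q : ℝ × ℝ} {c : ℝ} {P : ℝ × ℝ → Prop} (hW : Continuous W)
    (hq : W q ≤ c) (h : ∀ᶠ y in 𝓝 q, P y → c ≤ v y) :
    ∀ η > 0, ∀ᶠ y in 𝓝 q, P y → W y - η ≤ v y := by
  intro η hη
  have e2 : ∀ᶠ y in 𝓝 q, W y < W q + η :=
    hW.continuousAt.eventually_lt continuousAt_const (by linarith)
  filter_upwards [h, e2] with y h1 h2 h3
  linarith [h1 h3]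

lemma bd_of_lsc {v W : ℝ × ℝ → ℝ} {q : ℝ × ℝ} {P : ℝ × ℝ → Prop} (hW : Continuous W)
    (hv : LowerSemicontinuousAt v q) (hq : W q ≤ v q) :
    ∀ η > 0, ∀ᶠ y in 𝓝 q, P y → W y - η ≤ v y := by
  intro η hη
  have e2 : ∀ᶠ y in 𝓝 q, W y < W q + η / 2 :=
    hW.continuousAt.eventually_lt continuousAt_const (by linarith)
  filter_upwards [hv (v q - η / 2) (by linarith), e2] with y h1 h2 _
  linarith

/-- decay rate in `persist` -/
def LL (p ε β D r : ℝ) : ℝ := (((p - 1) * (2 * D / r) ^ (p - 2) + ε) * (2 * D / r ^ 2)) ^ β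

lemma persist {b p ε β : ℝ} {v : ℝ × ℝ → ℝ} (hv : SupS b p ε β v)
    (hp : 2 ≤ p) (hε : 0 < ε) (hβ : 0 < β) {x0 r M C s T : ℝ}
    (hr : 0 < r) (h1 : -b ≤ x0 - r) (h2 : x0 + r ≤ b) (hs : 0 < s) (hCM : C < M)
    (hC : ∀ x ∈ Ioo (x0 - r) (x0 + r), ∀ t ∈ Ioo s T, C ≤ v (x, t))
    (hM : ∀ x ∈ Ioo (x0 - r) (x0 + r), M ≤ v (x, s)) :
    ∀ t ∈ Ioo s T, M - LL p ε β (M - C) r * (t - s) ≤ v (x0, t) := by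
  intro t ht
  set L := LL p ε β (M - C) r with hL
  have hL0 : 0 ≤ L := by
    rw [hL, LL]
    have : 0 ≤ M - C := by linarith
    have : 0 ≤ p - 1 := by linarith
    positivity
  have hD : 0 < M - C := by linarith
  set C0 := (M - C) / r ^ 2 with hC0
  have hC0p : 0 < C0 := by positivity
  have hC0r : C0 * r ^ 2 = M - C := by simp only [hC0]; field_simp
  have hWc : Continuous (fun q : ℝ × ℝ => M - L * (q.2 - s) - C0 * (q.1 - x0) ^ 2) := by fun_prop
  have := comp hv h1 h2 hs.le (T := T) (fun q => M - L * (q.2 - s) - C0 * (q.1 - x0) ^ 2)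
    (fun _ _ => -L) (fun x _ => -(2 * C0 * (x - x0))) (fun _ _ => -(2 * C0)) (by fun_prop)
    ?_ ?_ ?_ ?_ ?_ x0 ⟨by linarith, by linarith⟩ t ht
  · simpa using this
  · intro x t
    have a1 := (((((hasDerivAt_id t).sub_const s).const_mul L).const_sub M).sub_const
      (C0 * (x - x0) ^ 2))
    refine a1.congr_deriv (by simp)
  · intro x t
    have a1 := ((((hasDerivAt_id x).sub_const x0).pow 2).const_mul C0).const_sub
      (M - L * (t - s))
    refine a1.congr_deriv (by simp; ring)
  · intro x t
    have a1 := (((hasDerivAt_id x).sub_const x0).const_mul (2 * C0)).neg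
    refine a1.congr_deriv (by simp)
  · intro x hx t ht _
    have h3 : |-(2 * C0 * (x - x0))| ≤ 2 * (M - C) / r := by
      have : 2 * (M - C) / r = 2 * C0 * r := by simp only [hC0]; field_simp
      rw [this, abs_neg, abs_mul, abs_of_pos (by positivity)]
      gcongr
      rw [abs_le]; constructor <;> linarith [hx.1, hx.2]
    have := HH_neg hp hε hβ h3 (z := 2 * C0) (by positivity)
    refine le_trans (le_of_eq ?_) this
    rw [hL, LL, hC0]; congr 3; ring
  · intro x hx t ht hor
    by_cases hxin : x = x0 - r ∨ x = x0 + r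
    · have hxr : (x - x0) ^ 2 = r ^ 2 := by
        rcases hxin with h | h <;> rw [h] <;> ring
      intro η hη
      have := bd_of_bound (v := v) (q := (x, t)) (c := C)
        (P := fun q => q.1 ∈ Ioo (x0 - r) (x0 + r) ∧ q.2 ∈ Ioo s T) hWc
        (by
          simp only
          rw [hxr, hC0r]
          have := mul_nonneg hL0 (sub_nonneg.2 ht.1)
          linarith)
        (Eventually.of_forall fun y hy => hC y.1 hy.1 y.2 hy.2) η hη
      filter_upwards [this] with y hy a1 a2 using hy ⟨a1, a2⟩
    · push Not at hxin
      have hts : t = s := by tauto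
      have hx' : x ∈ Ioo (x0 - r) (x0 + r) :=
        ⟨lt_of_le_of_ne hx.1 (Ne.symm hxin.1), lt_of_le_of_ne hx.2 hxin.2⟩
      subst hts
      intro η hη
      have := bd_of_lsc (v := v) (q := (x, t)) (P := fun _ => True) hWc
        (hv.lsc _ ⟨⟨by linarith [hx'.1], by linarith [hx'.2]⟩, hs⟩)
        (by
          have := hM x hx'
          have : 0 ≤ C0 * (x - x0) ^ 2 := by positivity
          simp only [sub_self, mul_zero]; linarith) η hη
      filter_upwards [this] with y hy a1 a2 using hy trivial

lemma persist_left {b p ε β : ℝ} {v : ℝ × ℝ → ℝ} (hv : SupS b p ε β v)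
    (hp : 2 ≤ p) (hε : 0 < ε) (hβ : 0 < β) {x0 r M t0 : ℝ}
    (hx0 : x0 ∈ Ioo (-b) b) (ht0 : 0 < t0) (hr : 0 < r)
    (h : ∀ δ > 0, ∃ s ∈ Ioo (t0 - δ) t0, ∀ x ∈ Ioo (x0 - r) (x0 + r), M ≤ v (x, s)) :
    M ≤ v (x0, t0) := by
  set C := min (v (x0, t0)) M - 1 with hC
  have hCv : C < v (x0, t0) := by have := min_le_left (v (x0, t0)) M; linarith
  have hCM : C < M := by have := min_le_right (v (x0, t0)) M; linarith
  obtain ⟨ρ, hρ, hball⟩ := Metric.eventually_nhds_iff.1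
    (hv.lsc (x0, t0) ⟨hx0, ht0⟩ C hCv)
  obtain ⟨r', hr'0, hr'1, hr'2, hr'3, hr'4⟩ :
      ∃ r' > 0, r' ≤ r ∧ r' ≤ ρ ∧ r' ≤ b - x0 ∧ r' ≤ x0 + b :=
    ⟨min (min r ρ) (min (b - x0) (x0 + b)),
      lt_min (lt_min hr hρ) (lt_min (by linarith [hx0.2]) (by linarith [hx0.1])),
      (min_le_left _ _).trans (min_le_left _ _), (min_le_left _ _).trans (min_le_right _ _),
      (min_le_right _ _).trans (min_le_left _ _), (min_le_right _ _).trans (min_le_right _ _)⟩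
  set L := LL p ε β (M - C) r' with hL
  have hL0 : 0 ≤ L := by
    rw [hL, LL]
    have : 0 ≤ M - C := by linarith
    have : 0 ≤ p - 1 := by linarith
    positivity
  apply le_of_forall_pos_le_add
  intro η hη
  obtain ⟨s, hs, hsM⟩ := h (min (min ρ t0) (η / (L + 1))) (by positivity)
  have hs1 : t0 - s < ρ := by
    have := (min_le_left (min ρ t0) (η / (L + 1))).trans (min_le_left _ _); linarith [hs.1]
  have hs2 : 0 < s := by
    have := (min_le_left (min ρ t0) (η / (L + 1))).trans (min_le_right _ _); linarith [hs.1]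
  have hs3 : t0 - s < η / (L + 1) := by
    have := (min_le_right (min ρ t0) (η / (L + 1))); linarith [hs.1]
  have := persist hv hp hε hβ (x0 := x0) (r := r') (M := M) (C := C) (s := s) (T := t0 + ρ)
    hr'0 (by linarith) (by linarith) hs2 hCM
    (by
      intro x hx t ht
      apply le_of_lt
      apply hball
      rw [Prod.dist_eq, max_lt_iff, Real.dist_eq, Real.dist_eq, abs_lt, abs_lt]
      refine ⟨⟨?_, ?_⟩, ?_, ?_⟩ <;> simp only <;> linarith [hx.1, hx.2, ht.1, ht.2])
    (fun x hx => hsM x ⟨by linarith [hx.1], by linarith [hx.2]⟩) t0 ⟨hs.2, by linarith⟩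
  rw [← hL] at this
  rw [lt_div_iff₀ (by positivity)] at hs3
  have : 0 ≤ t0 - s := by linarith [hs.2]
  nlinarith

/-- local lower bound near the boundary point `(b,t)` -/
def LB (b : ℝ) (v : ℝ × ℝ → ℝ) (t M : ℝ) : Prop :=
  ∃ ρ > 0, ∀ x ∈ Ioo (b - ρ) b, ∀ s ∈ Ioo (t - ρ) (t + ρ), M ≤ v (x, s)

lemma LB.ev {b : ℝ} {v : ℝ × ℝ → ℝ} {t M : ℝ} (h : LB b v t M) :
    ∀ᶠ y : ℝ × ℝ in 𝓝 (b, t), y.1 < b → M ≤ v y := by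
  obtain ⟨ρ, hρ, h⟩ := h
  have e : Ioo (b - ρ) (b + ρ) ×ˢ Ioo (t - ρ) (t + ρ) ∈ 𝓝 (b, t) :=
    prod_mem_nhds (Ioo_mem_nhds (by linarith) (by linarith))
      (Ioo_mem_nhds (by linarith) (by linarith))
  filter_upwards [e] with y hy hy2
  exact h y.1 ⟨hy.1.1, hy2⟩ y.2 hy.2

lemma LB.mono {b : ℝ} {v : ℝ × ℝ → ℝ} {t M M' : ℝ} (h : LB b v t M) (hM : M' ≤ M) :
    LB b v t M' := by
  obtain ⟨ρ, hρ, h⟩ := h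
  exact ⟨ρ, hρ, fun x hx s hs => hM.trans (h x hx s hs)⟩

lemma LB_open (b : ℝ) (v : ℝ × ℝ → ℝ) (M : ℝ) : IsOpen {t | LB b v t M} := by
  rw [Metric.isOpen_iff]
  rintro t ⟨ρ, hρ, h⟩
  refine ⟨ρ / 2, by positivity, fun s hs => ⟨ρ / 2, by positivity, fun x hx r hr => ?_⟩⟩
  rw [Metric.mem_ball, Real.dist_eq, abs_lt] at hs
  exact h x ⟨by linarith [hx.1], hx.2⟩ r ⟨by linarith [hr.1], by linarith [hr.2]⟩

lemma LL_bound {p ε β D y : ℝ} (hp : 2 ≤ p) (hε : 0 < ε) (hβ : 0 < β) (hD : 0 < D)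
    (hy : 0 < y) (hy1 : y ≤ 1) :
    LL p ε β D (y / 2) * y ^ (p * β) ≤ (((p - 1) * (4 * D) ^ (p - 2) + ε) * (8 * D)) ^ β := by
  have hp1 : 0 ≤ p - 1 := by linarith
  rw [LL, Real.rpow_mul hy.le, ← Real.mul_rpow (by positivity) (by positivity)]
  apply Real.rpow_le_rpow (by positivity) _ hβ.le
  have e1 : y ^ p = y ^ (p - 2) * y ^ 2 := by
    rw [← Real.rpow_natCast, ← Real.rpow_add hy]; congr 1; push_cast; ring
  have e2 : (2 * D / (y / 2)) ^ (p - 2) * y ^ (p - 2) = (4 * D) ^ (p - 2) := by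
    rw [← Real.mul_rpow (by positivity) hy.le]; congr 1; field_simp; ring
  have e3 : y ^ (p - 2) ≤ 1 := Real.rpow_le_one hy.le hy1 (by linarith)
  calc ((p - 1) * (2 * D / (y / 2)) ^ (p - 2) + ε) * (2 * D / (y / 2) ^ 2) * y ^ p
      = ((p - 1) * ((2 * D / (y / 2)) ^ (p - 2) * y ^ (p - 2)) + ε * y ^ (p - 2)) * (8 * D) := by
        rw [e1]; field_simp; ring
    _ ≤ _ := by
        rw [e2]
        gcongr
        nlinarith

lemma corner_persist {b p ε β : ℝ} {v : ℝ × ℝ → ℝ} (hv : SupS b p ε β v)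
    (hp : 2 ≤ p) (hε : 0 < ε) (hβ : 0 < β) {r M m0 a T : ℝ}
    (hr : 0 < r) (h1 : -b ≤ b - r) (ha : 0 < a) (hm : m0 < M)
    (hC : ∀ x ∈ Ioo (b - r) b, ∀ t ∈ Ioo a T, m0 ≤ v (x, t))
    (hM : ∀ x ∈ Ioo (b - r) b, M ≤ v (x, a)) {δ : ℝ} (hδ : 0 < δ) :
    ∃ lam > 0, ∃ ρ > 0, ρ ≤ r ∧ ∀ y ∈ Ioo 0 ρ, ∀ t ∈ Ioo a T, t - a ≤ lam * y ^ (p * β) →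
      M - δ ≤ v (b - y, t) := by
  have hD : 0 < M - m0 := by linarith
  have hp1 : 0 < p - 1 := by linarith
  set G := (((p - 1) * (4 * (M - m0)) ^ (p - 2) + ε) * (8 * (M - m0))) ^ β with hG
  have hG0 : 0 < G := by positivity
  refine ⟨δ / G, by positivity, min 1 (r / 2), by positivity,
    (min_le_right _ _).trans (by linarith), ?_⟩
  intro y hy t ht hty
  have hy1 : y ≤ 1 := hy.2.le.trans (min_le_left _ _)
  have hy2 : y < r / 2 := hy.2.trans_le (min_le_right _ _)
  have hy0 : 0 < y := hy.1
  have := persist hv hp hε hβ (x0 := b - y) (r := y / 2) (M := M) (C := m0) (s := a) (T := T)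
    (by linarith) (by linarith) (by linarith) ha hm
    (fun x hx t ht => hC x ⟨by linarith [hx.1], by linarith [hx.2]⟩ t ht)
    (fun x hx => hM x ⟨by linarith [hx.1], by linarith [hx.2]⟩) t ht
  have hb := LL_bound (ε := ε) hp hε hβ hD hy0 hy1
  rw [← hG] at hb
  have hL0 : 0 ≤ LL p ε β (M - m0) (y / 2) := by rw [LL]; positivity
  have : LL p ε β (M - m0) (y / 2) * (t - a) ≤ δ := by
    calc _ ≤ LL p ε β (M - m0) (y / 2) * (δ / G * y ^ (p * β)) := by gcongr
      _ = (LL p ε β (M - m0) (y / 2) * y ^ (p * β)) * (δ / G) := by ring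
      _ ≤ G * (δ / G) := by gcongr
      _ = δ := by field_simp
  linarith

lemma corner_step {b p ε β : ℝ} {v : ℝ × ℝ → ℝ} (hv : SupS b p ε β v)
    (hp : 2 ≤ p) (hε : 0 < ε) (hβ : 0 < β) {r M a T lam ρ δ : ℝ}
    (h1 : -b ≤ b - r) (ha : 0 < a) (haT : a < T)
    (hM : ∀ x ∈ Ioo (b - r) b, M ≤ v (x, a))
    (hLB : ∀ t ∈ Ioo a T, LB b v t M)
    (hδ : 0 < δ) (hlam : 0 < lam) (hρ : 0 < ρ) (hρr : ρ ≤ r)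
    (hP : ∀ y ∈ Ioo 0 ρ, ∀ t ∈ Ioo a T, t - a ≤ lam * y ^ (p * β) → M - δ / 2 ≤ v (b - y, t)) :
    ∃ κ > 0, ∀ D, δ ≤ D →
      (∃ ρ1 > 0, ∀ x ∈ Ioo (b - ρ1) b, ∀ t ∈ Ioo a (a + ρ1), M - D ≤ v (x, t)) →
      (∃ ρ1 > 0, ∀ x ∈ Ioo (b - ρ1) b, ∀ t ∈ Ioo a (a + ρ1), M - D + κ ≤ v (x, t)) := by
  have hp1 : 0 < p - 1 := by linarith
  have hq : 0 < p * β := by positivity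
  set e := δ / 8 with he
  have he0 : 0 < e := by positivity
  set E := (2 * e ^ (p - 1)) ^ β with hE
  have hE0 : 0 < E := by positivity
  set κ := min (δ / 8) (lam * E / 2) with hκ
  have hκ0 : 0 < κ := by positivity
  have hκ1 : κ ≤ δ / 8 := min_le_left _ _
  have hκ2 : κ ≤ lam * E / 2 := min_le_right _ _
  refine ⟨κ / 2, by positivity, ?_⟩
  rintro D hD ⟨ρ1, hρ1, hv1⟩
  set R0 := min ρ ρ1 / 2 with hR0
  have hR00 : 0 < R0 := by positivity
  have hR01 : R0 < ρ := by have := min_le_left ρ ρ1; simp only [hR0]; linarith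
  have hR02 : R0 < ρ1 := by have := min_le_right ρ ρ1; simp only [hR0]; linarith
  obtain ⟨ρ2, hρ2, k1, k2, k3, k4⟩ : ∃ ρ2 > 0, ρ2 ≤ lam * R0 ^ (p * β) / 4 ∧ ρ2 ≤ ρ ∧
      ρ2 ≤ ρ1 / 2 ∧ ρ2 ≤ (T - a) / 2 := by
    have : 0 < T - a := by linarith
    refine ⟨min (min (lam * R0 ^ (p * β) / 4) ρ) (min (ρ1 / 2) ((T - a) / 2)), by positivity,
      (min_le_left _ _).trans (min_le_left _ _), (min_le_left _ _).trans (min_le_right _ _),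
      (min_le_right _ _).trans (min_le_left _ _), (min_le_right _ _).trans (min_le_right _ _)⟩
  refine ⟨ρ2, hρ2, ?_⟩
  intro x hx t ht
  obtain ⟨h, rfl⟩ : ∃ h, t = a + h := ⟨t - a, by ring⟩
  have hh0 : 0 < h := by linarith [ht.1]
  have hh1 : h < ρ2 := by linarith [ht.2]
  set R := (4 * h / lam) ^ (p * β)⁻¹ with hR
  have hRp : 0 < R := by positivity
  have hRq : R ^ (p * β) = 4 * h / lam := by
    rw [hR, Real.rpow_inv_rpow (by positivity) hq.ne']
  have hRq' : lam * R ^ (p * β) = 4 * h := by rw [hRq]; field_simp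
  have hRR0 : R < R0 := by
    rw [hR]
    rw [Real.rpow_inv_lt_iff_of_pos (by positivity) hR00.le hq, div_lt_iff₀ hlam]
    linarith
  by_cases hy : R ≤ b - x
  · have := hP (b - x) ⟨by linarith [hx.2], by linarith [hx.1]⟩ (a + h)
      ⟨by linarith, by linarith⟩ (by
        have : R ^ (p * β) ≤ (b - x) ^ (p * β) := Real.rpow_le_rpow hRp.le hy hq.le
        have := mul_le_mul_of_nonneg_left this hlam.le
        linarith)
    rw [sub_sub_cancel] at this
    linarith
  push Not at hy
  set W : ℝ × ℝ → ℝ := fun q => M - D + κ / (2 * h) * (q.2 - a) +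
    e * ((b - q.1) ^ 2 / R ^ 2 + (b - q.1) / R) with hWdef
  have hWC : ContDiff ℝ 2 W := by simp only [hWdef]; fun_prop
  have hWc : Continuous W := hWC.continuous
  have kh : ∀ t ≤ a + 2 * h, κ / (2 * h) * (t - a) ≤ κ := by
    intro t ht
    rw [div_mul_eq_mul_div, div_le_iff₀ (by positivity)]
    have : t - a ≤ 2 * h := by linarith
    gcongr
  have ke : ∀ x ∈ Icc (b - R) b, e * ((b - x) ^ 2 / R ^ 2 + (b - x) / R) ≤ 2 * e := by
    intro x hx
    have h0 : 0 ≤ (b - x) / R := div_nonneg (by linarith [hx.2]) hRp.le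
    have h1 : (b - x) / R ≤ 1 := by rw [div_le_one hRp]; linarith [hx.1]
    rw [← div_pow]
    have : ((b - x) / R) ^ 2 ≤ 1 := by nlinarith
    nlinarith
  have hcmp := comp hv (x1 := b - R) (x2 := b) (s := a) (T := a + 2 * h) (by linarith) le_rfl
    ha.le W (fun _ _ => κ / (2 * h)) (fun x _ => -(e * (2 * (b - x) / R ^ 2 + 1 / R)))
    (fun _ _ => 2 * e / R ^ 2) hWC ?_ ?_ ?_ ?_ ?_ x ⟨by linarith, hx.2⟩ (a + h)
    ⟨by linarith, by linarith⟩
  · refine le_trans ?_ hcmp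
    have h0 : 0 < b - x := by linarith [hx.2]
    have : 0 ≤ e * ((b - x) ^ 2 / R ^ 2 + (b - x) / R) := by positivity
    have h3 : κ / (2 * h) * (a + h - a) = κ / 2 := by field_simp; ring
    simp only [hWdef]
    rw [h3]; linarith
  · intro x t
    have a1 := ((((hasDerivAt_id t).sub_const a).const_mul (κ / (2 * h))).const_add
      (M - D)).add_const (e * ((b - x) ^ 2 / R ^ 2 + (b - x) / R))
    exact a1.congr_deriv (by simp)
  · intro x t
    have a0 := (hasDerivAt_id x).const_sub b
    have a1 := ((((a0.pow 2).div_const (R ^ 2)).add (a0.div_const R)).const_mul e).const_add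
      (M - D + κ / (2 * h) * (t - a))
    exact a1.congr_deriv (by simp; ring)
  · intro x t
    have a0 := (hasDerivAt_id x).const_sub b
    have a1 := ((((a0.const_mul 2).div_const (R ^ 2)).add_const (1 / R)).const_mul e).neg
    exact a1.congr_deriv (by simp; ring)
  · intro x hx t ht _
    have h0 : 0 < b - x := by linarith [hx.2]
    have ha0 : e / R ≤ |-(e * (2 * (b - x) / R ^ 2 + 1 / R))| := by
      rw [abs_neg, abs_of_pos (by positivity)]
      have : 0 ≤ e * (2 * (b - x) / R ^ 2) := by positivity
      rw [mul_add, mul_one_div]; linarith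
    refine le_trans ?_ (HH_lower hp hε hβ (a0 := e / R) (z := 2 * e / R ^ 2) (by positivity)
      ha0 (by positivity))
    have e0 : ((e / R) ^ (p - 2) * (2 * e / R ^ 2)) ^ β * R ^ (p * β) = E := by
      rw [Real.rpow_mul hRp.le, ← Real.mul_rpow (by positivity) (by positivity), hE]
      congr 1
      have e1 : R ^ p = R ^ (p - 2) * R ^ 2 := by
        rw [← Real.rpow_natCast, ← Real.rpow_add hRp]; congr 1; push_cast; ring
      have e2 : e ^ (p - 1) = e ^ (p - 2) * e := by
        rw [← Real.rpow_add_one he0.ne']; congr 1; ring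
      rw [e1, e2, Real.div_rpow he0.le hRp.le]
      have : R ^ (p - 2) ≠ 0 := by positivity
      field_simp
    have hRqp : 0 < R ^ (p * β) := by positivity
    rw [← mul_le_mul_iff_left₀ hRqp, e0, hRq]
    have : κ / (2 * h) * (4 * h / lam) = 2 * κ / lam := by field_simp; ring
    rw [this, div_le_iff₀ hlam]; linarith
  · intro x hx t ht hor η hη
    rcases eq_or_lt_of_le hx.2 with hxb | hxb
    · subst hxb
      rcases eq_or_lt_of_le ht.1 with hta | hta
      · subst hta
        have := bd_of_bound (v := v) (q := (x, a)) (c := M - D)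
          (P := fun q => q.1 ∈ Ioo (x - R) x ∧ q.2 ∈ Ioo a (a + 2 * h)) hWc
          (by simp [hWdef])
          (Eventually.of_forall fun y hy => hv1 y.1 ⟨by linarith [hy.1.1], hy.1.2⟩ y.2
            ⟨hy.2.1, by linarith [hy.2.2]⟩) η hη
        filter_upwards [this] with y hy a1 a2 using hy ⟨a1, a2⟩
      · have := bd_of_bound (v := v) (q := (x, t)) (c := M) (P := fun q => q.1 < x) hWc
          (by
            have := kh t ht.2
            simp only [hWdef, sub_self]
            simp; linarith) (hLB t ⟨hta, by linarith [ht.2]⟩).ev η hη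
        filter_upwards [this] with y hy a1 a2 using hy a1.2
    · have hQ : (x, t) ∈ Qset b := ⟨⟨by linarith [hx.1], hxb⟩, by
        show 0 < t
        linarith [ht.1]⟩
      have hW' : W (x, t) ≤ v (x, t) := by
        rcases eq_or_lt_of_le ht.1 with hta | hta
        · subst hta
          have := ke x hx
          have := hM x ⟨by linarith [hx.1], hxb⟩
          simp only [hWdef, sub_self, mul_zero]
          linarith
        · have hxR : x = b - R := by
            rcases hor with h | h | h
            · exact h
            · linarith
            · linarith
          have h3 := hP R ⟨hRp, by linarith⟩ t ⟨hta, by linarith [ht.2]⟩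
            (by linarith [ht.2])
          rw [← hxR] at h3
          have := ke x hx
          have := kh t ht.2
          simp only [hWdef]
          linarith
      have := bd_of_lsc (P := fun _ => True) hWc (hv.lsc _ hQ) hW' η hη
      filter_upwards [this] with y hy a1 a2 using hy trivial

lemma corner {b p ε β : ℝ} {v : ℝ × ℝ → ℝ} (hv : SupS b p ε β v)
    (hp : 2 ≤ p) (hε : 0 < ε) (hβ : 0 < β) {r M m0 a T : ℝ}
    (hr : 0 < r) (h1 : -b ≤ b - r) (ha : 0 < a) (haT : a < T) (hm : m0 < M)
    (hC : ∀ x ∈ Ioo (b - r) b, ∀ t ∈ Ioo a T, m0 ≤ v (x, t))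
    (hM : ∀ x ∈ Ioo (b - r) b, M ≤ v (x, a))
    (hLB : ∀ t ∈ Ioo a T, LB b v t M) {δ : ℝ} (hδ : 0 < δ) :
    ∃ ρ > 0, ∀ x ∈ Ioo (b - ρ) b, ∀ t ∈ Ioo a (a + ρ), M - δ ≤ v (x, t) := by
  obtain ⟨lam, hlam, ρ, hρ, hρr, hP⟩ := corner_persist hv hp hε hβ hr h1 ha hm hC hM
    (half_pos hδ)
  obtain ⟨κ, hκ, hstep⟩ := corner_step hv hp hε hβ h1 ha haT hM hLB hδ hlam hρ hρr hP
  have key : ∀ k : ℕ, ∃ ρ1 > 0, ∀ x ∈ Ioo (b - ρ1) b, ∀ t ∈ Ioo a (a + ρ1),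
      M - max δ ((M - m0) - k * κ) ≤ v (x, t) := by
    intro k
    induction k with
    | zero =>
      refine ⟨min r (T - a), lt_min hr (by linarith), fun x hx t ht => ?_⟩
      have k1 := min_le_left r (T - a)
      have k2 := min_le_right r (T - a)
      have := hC x ⟨by linarith [hx.1], hx.2⟩ t ⟨ht.1, by linarith [ht.2]⟩
      have := le_max_right δ ((M - m0) - (0 : ℕ) * κ)
      simp only [Nat.cast_zero, zero_mul, sub_zero] at this ⊢
      linarith
    | succ k ih =>
      obtain ⟨ρ1, hρ1, h⟩ := hstep _ (le_max_left _ _) ih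
      refine ⟨ρ1, hρ1, fun x hx t ht => le_trans ?_ (h x hx t ht)⟩
      have : max δ ((M - m0) - k * κ) ≤ max δ ((M - m0) - (k + 1 : ℕ) * κ) + κ := by
        apply max_le
        · linarith [le_max_left δ ((M - m0) - (k + 1 : ℕ) * κ)]
        · have := le_max_right δ ((M - m0) - (k + 1 : ℕ) * κ)
          push_cast at this ⊢
          linarith
      linarith
  obtain ⟨k, hk⟩ := exists_nat_gt ((M - m0) / κ)
  rw [div_lt_iff₀ hκ] at hk
  have := key k
  rwa [max_eq_left (by linarith)] at this

lemma gap {b p ε β : ℝ} {v : ℝ × ℝ → ℝ} (hv : SupS b p ε β v)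
    (hp : 2 ≤ p) (hε : 0 < ε) (hβ : 0 < β) {r M m0 a T : ℝ}
    (hr : 0 < r) (h1 : -b ≤ b - r) (ha : 0 < a) (hm : m0 < M)
    (hC : ∀ x ∈ Ioo (b - r) b, ∀ t ∈ Ioo a T, m0 ≤ v (x, t))
    (hM : ∀ x ∈ Ioo (b - r) b, M ≤ v (x, a))
    (hLB : ∀ t ∈ Ioo a T, LB b v t M) :
    ∀ x ∈ Ioo (b - r) b, ∀ t ∈ Ioo a T, M - (M - m0) / r * (b - x) ≤ v (x, t) := by
  intro x hx t ht
  have haT : a < T := ht.1.trans ht.2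
  set K := (M - m0) / r with hK
  have hD : 0 < M - m0 := by linarith
  have hK0 : 0 < K := by positivity
  have hKr : K * r = M - m0 := by simp only [hK]; field_simp
  have hWc : Continuous (fun q : ℝ × ℝ => M - K * (b - q.1)) := by fun_prop
  have := comp hv (x1 := b - r) (x2 := b) (s := a) (T := (t + T) / 2) h1 le_rfl
    ha.le (fun q => M - K * (b - q.1)) (fun _ _ => 0) (fun x _ => K)
    (fun _ _ => 0) (by fun_prop) ?_ ?_ ?_ ?_ ?_ x hx t ⟨ht.1, by linarith [ht.2]⟩
  · exact this
  · intro x t; exact hasDerivAt_const t (M - K * (b - x))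
  · intro x t
    have a1 := (((hasDerivAt_id x).const_sub b).const_mul K).const_sub M
    exact a1.congr_deriv (by simp)
  · intro x t; exact hasDerivAt_const x K
  · intro x _ t _ _; rw [HH_zero]
  · intro x hx t' ht' hor η hη
    have ht'T : t' < T := by linarith [ht'.2, ht.2]
    by_cases hxb : x = b
    · subst hxb
      rcases eq_or_lt_of_le ht'.1 with hta | hta
      · subst hta
        obtain ⟨ρ, hρ, h⟩ := corner hv hp hε hβ hr h1 ha haT hm hC hM hLB hη
        have e : Ioo (x - ρ) (x + ρ) ×ˢ Ioo (a - ρ) (a + ρ) ∈ 𝓝 (x, a) :=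
          prod_mem_nhds (Ioo_mem_nhds (by linarith) (by linarith))
            (Ioo_mem_nhds (by linarith) (by linarith))
        filter_upwards [e] with y hy a1 a2
        have := h y.1 ⟨hy.1.1, a1.2⟩ y.2 ⟨a2.1, hy.2.2⟩
        have : 0 ≤ K * (x - y.1) := mul_nonneg hK0.le (by linarith [a1.2])
        show M - K * (x - y.1) - η ≤ v (y.1, y.2)
        linarith
      · have := bd_of_bound (v := v) (q := (x, t')) (c := M) (P := fun q => q.1 < x) hWc
          (by simp) (hLB t' ⟨hta, ht'T⟩).ev η hη
        filter_upwards [this] with y hy a1 a2 using hy a1.2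
    · by_cases hxr : x = b - r
      · have := bd_of_bound (v := v) (q := (x, t')) (c := m0)
          (P := fun q => q.1 ∈ Ioo (b - r) b ∧ q.2 ∈ Ioo a T) hWc
          (by simp only [hxr, sub_sub_cancel]; linarith)
          (Eventually.of_forall fun y hy => hC y.1 hy.1 y.2 hy.2) η hη
        filter_upwards [this] with y hy a1 a2 using hy ⟨a1, a2.1, by linarith [a2.2, ht.2]⟩
      · have hta : t' = a := by tauto
        subst hta
        have hx' : x ∈ Ioo (b - r) b :=
          ⟨lt_of_le_of_ne hx.1 (Ne.symm hxr), lt_of_le_of_ne hx.2 hxb⟩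
        have := bd_of_lsc (v := v) (q := (x, t')) (P := fun _ => True) hWc
          (hv.lsc _ ⟨⟨by linarith [hx'.1], hx'.2⟩, ha⟩)
          (by
            have := hM x hx'
            have : 0 ≤ K * (b - x) := mul_nonneg hK0.le (by linarith [hx'.2])
            simp only; linarith) η hη
        filter_upwards [this] with y hy a1 a2 using hy trivial

lemma keyJ {b p ε β : ℝ} {v : ℝ × ℝ → ℝ} (hv : SupS b p ε β v)
    (hp : 2 ≤ p) (hε : 0 < ε) (hβ : 0 < β) {r M m0 c d τ0 : ℝ}
    (hr : 0 < r) (h1 : -b ≤ b - r) (hc : 0 ≤ c) (hm : m0 < M)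
    (hC : ∀ x ∈ Ioo (b - r) b, ∀ t ∈ Ioo c d, m0 ≤ v (x, t))
    (A : Set ℝ) (hA : ∀ τ ∈ A, ∀ x ∈ Ioo (b - r) b, M ≤ v (x, τ))
    (hτ : τ0 ∈ A) (hτc : c < τ0)
    (hJ : ∀ t ∈ Ioo c d, t ∈ closure A ∨ LB b v t M) :
    ∀ t ∈ Ioo τ0 d, ∀ x ∈ Ioo (b - r) b, M - (M - m0) / r * (b - x) ≤ v (x, t) := by
  intro t ht x hx
  have hD : 0 < M - m0 := by linarith
  set K := (M - m0) / r with hK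
  have hK0 : 0 < K := by positivity
  set B := A ∩ Iic t with hB
  have hBne : B.Nonempty := ⟨τ0, hτ, ht.1.le⟩
  have hBb : BddAbove B := ⟨t, fun y hy => hy.2⟩
  set a := sSup B with ha
  have ha1 : τ0 ≤ a := le_csSup hBb ⟨hτ, ht.1.le⟩
  have ha2 : a ≤ t := csSup_le hBne fun y hy => hy.2
  have ha0 : 0 < a := by linarith
  have hva : ∀ x ∈ Ioo (b - r) b, M ≤ v (x, a) := by
    intro x hx
    by_cases haA : a ∈ A
    · exact hA a haA x hx
    · set r' := min (b - x) (x - (b - r)) with hr'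
      have k1 : r' ≤ b - x := min_le_left _ _
      have k2 : r' ≤ x - (b - r) := min_le_right _ _
      apply persist_left hv hp hε hβ ⟨by linarith [hx.1], hx.2⟩ ha0 (r := r')
        (lt_min (by linarith [hx.2]) (by linarith [hx.1]))
      intro δ hδ
      obtain ⟨s, hs, hs2⟩ := exists_lt_of_lt_csSup hBne (show a - δ < sSup B by linarith)
      have hsa : s ≤ a := le_csSup hBb hs
      have hsne : s ≠ a := fun h => haA (h ▸ hs.1)
      exact ⟨s, ⟨hs2, lt_of_le_of_ne hsa hsne⟩, fun y hy => hA s hs.1 y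
        ⟨by linarith [hy.1], by linarith [hy.2]⟩⟩
  rcases eq_or_lt_of_le ha2 with hat | hat
  · have := hva x hx
    rw [hat] at this
    have : 0 ≤ K * (b - x) := mul_nonneg hK0.le (by linarith [hx.2])
    linarith
  · have hLB : ∀ s ∈ Ioo a t, LB b v s M := by
      intro s hs
      rcases hJ s ⟨by linarith [hs.1], by linarith [hs.2, ht.2]⟩ with h | h
      · exfalso
        obtain ⟨y, hy1, hy2⟩ := mem_closure_iff.1 h (Ioo a t) isOpen_Ioo hs
        have : y ≤ a := le_csSup hBb ⟨hy2, hy1.2.le⟩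
        linarith [hy1.1]
      · exact h
    have hg := gap hv hp hε hβ hr h1 ha0 hm
      (fun x hx s hs => hC x hx s ⟨by linarith [hs.1], by linarith [hs.2, ht.2]⟩) hva hLB
    apply le_of_forall_pos_le_add
    intro η hη
    set r' := min (min (b - x) (x - (b - r))) (η / K) with hr'
    have k1 : r' ≤ b - x := (min_le_left _ _).trans (min_le_left _ _)
    have k2 : r' ≤ x - (b - r) := (min_le_left _ _).trans (min_le_right _ _)
    have k3 : r' ≤ η / K := min_le_right _ _
    have k4 : K * r' ≤ η := by rw [le_div_iff₀ hK0] at k3; linarith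
    have := persist_left hv hp hε hβ (x0 := x) (M := M - K * (b - x) - η) (t0 := t) (r := r')
        ⟨by linarith [hx.1], hx.2⟩ (by linarith)
        (lt_min (lt_min (by linarith [hx.2]) (by linarith [hx.1])) (by positivity)) (by
      intro δ hδ
      refine ⟨(max a (t - δ) + t) / 2, ⟨?_, ?_⟩, ?_⟩
      · linarith [le_max_right a (t - δ)]
      · have : max a (t - δ) < t := max_lt hat (by linarith)
        linarith
      · intro y hy
        have h5 := hg y ⟨by linarith [hy.1], by linarith [hy.2]⟩ ((max a (t - δ) + t) / 2)
          ⟨by linarith [le_max_left a (t - δ)], by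
            have : max a (t - δ) < t := max_lt hat (by linarith)
            linarith⟩
        have : K * (b - y) ≤ K * (b - x + r') := by
          apply mul_le_mul_of_nonneg_left _ hK0.le; linarith [hy.1]
        rw [← hK] at h5
        linarith)
    linarith

lemma baire_portion {K U : Set ℝ} (hK : IsLocallyClosed K) (hne : K.Nonempty) (hU : IsOpen U)
    (hKU : K ⊆ U) (A : ℕ → Set ℝ) (hcov : K ⊆ ⋃ n, A n) :
    ∃ n, ∃ c d : ℝ, (∃ t ∈ K, t ∈ Ioo c d) ∧ Ioo c d ⊆ U ∧ K ∩ Ioo c d ⊆ closure (K ∩ A n) := by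
  haveI : LocallyCompactSpace K := hK.locallyCompactSpace
  haveI : Nonempty K := hne.to_subtype
  obtain ⟨n, x, hx⟩ := nonempty_interior_of_iUnion_of_closed
    (f := fun n => closure ((↑) ⁻¹' A n : Set K)) (fun n => isClosed_closure) (by
      rw [eq_univ_iff_forall]
      intro x
      obtain ⟨n, hn⟩ := mem_iUnion.1 (hcov x.2)
      exact mem_iUnion.2 ⟨n, subset_closure hn⟩)
  obtain ⟨V, hV, hVe⟩ := isOpen_induced_iff.1 (isOpen_interior (s := closure ((↑) ⁻¹' A n : Set K)))
  have hxV : (x : ℝ) ∈ V := by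
    have : x ∈ ((↑) ⁻¹' V : Set K) := by rw [hVe]; exact hx
    exact this
  obtain ⟨c, d, hcd, hsub⟩ := mem_nhds_iff_exists_Ioo_subset.1
    ((hV.inter hU).mem_nhds ⟨hxV, hKU x.2⟩)
  refine ⟨n, c, d, ⟨x, x.2, hcd⟩, fun y hy => (hsub hy).2, ?_⟩
  rintro t ⟨htK, ht⟩
  have h1 : (⟨t, htK⟩ : K) ∈ interior (closure ((↑) ⁻¹' A n : Set K)) := by
    rw [← hVe]; exact (hsub ht).1
  have h2 := closure_subtype.1 (interior_subset h1)
  refine closure_mono ?_ h2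
  rintro y ⟨z, hz, rfl⟩
  exact ⟨z.2, hz⟩

/-- times at which `v ≥ M` on a strip of width `1/(n+1)` -/
def AA (b : ℝ) (v : ℝ × ℝ → ℝ) (M : ℝ) (n : ℕ) : Set ℝ :=
  {t | ∀ x ∈ Ioo (b - 1 / ((n : ℝ) + 1)) b, M ≤ v (x, t)}

lemma AA_cov {b p ε β : ℝ} {v : ℝ × ℝ → ℝ} (hv : SupS b p ε β v) (M : ℝ) {t : ℝ} (ht : 0 < t) :
    t ∈ ⋃ n, AA b v M n := by
  have h := (hv.bc t ht).eventually_ge_atTop M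
  obtain ⟨l, hl, hl2⟩ := mem_nhdsLT_iff_exists_Ioo_subset.1 h
  obtain ⟨n, hn⟩ := exists_nat_one_div_lt (show 0 < b - l by have : l < b := hl; linarith)
  exact mem_iUnion.2 ⟨n, fun x hx => hl2 ⟨by linarith [hx.1], hx.2⟩⟩

lemma first {b p ε β : ℝ} {v : ℝ × ℝ → ℝ} (hb : 0 < b) (hv : SupS b p ε β v)
    (hp : 2 ≤ p) (hε : 0 < ε) (hβ : 0 < β) :
    ∃ c d r : ℝ, 0 ≤ c ∧ c < d ∧ 0 < r ∧ r ≤ b ∧ r ≤ 1 / 2 ∧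
      ∀ x ∈ Ioo (b - r) b, ∀ t ∈ Ioo c d, 0 ≤ v (x, t) := by
  obtain ⟨n, c, d, ⟨t, -, ht⟩, hsub, hcl⟩ := baire_portion (K := Ioi 0) (U := Ioi 0)
    isOpen_Ioi.isLocallyClosed ⟨1, by simp⟩ isOpen_Ioi le_rfl (AA b v 0)
    (fun t ht => AA_cov hv 0 ht)
  have hcd : c < d := ht.1.trans ht.2
  have hc : 0 ≤ c := by
    by_contra h
    push Not at h
    have : (max c (-1) + min d 0) / 2 ∈ Ioo c d := by
      have h1 : c < min d 0 := lt_min hcd h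
      have h2 : -1 < d := by
        have : 0 < t := hsub ht
        linarith [ht.2]
      have h3 : max c (-1) < min d 0 := max_lt h1 (lt_min h2 (by norm_num))
      constructor
      · linarith [le_max_left c (-1)]
      · linarith [min_le_left d 0]
    have h0 : 0 < (max c (-1) + min d 0) / 2 := hsub this
    have := min_le_right d 0
    have : max c (-1) < 0 := max_lt h (by norm_num)
    linarith
  have hn0 : (0 : ℝ) < 1 / ((n : ℝ) + 1) := by positivity
  refine ⟨c, d, min (1 / ((n : ℝ) + 1)) (min b (1 / 2)), hc, hcd, by positivity,
    (min_le_right _ _).trans (min_le_left _ _), (min_le_right _ _).trans (min_le_right _ _), ?_⟩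
  intro x hx s hs
  have k1 := min_le_left (1 / ((n : ℝ) + 1)) (min b (1 / 2))
  have k2 := (min_le_right (1 / ((n : ℝ) + 1)) (min b (1 / 2))).trans (min_le_left _ _)
  set r := min (1 / ((n : ℝ) + 1)) (min b (1 / 2))
  have hs0 : 0 < s := hsub hs
  apply persist_left hv hp hε hβ (r := min (b - x) (x - (b - r)))
    ⟨by linarith [hx.1], hx.2⟩ hs0 (lt_min (by linarith [hx.2]) (by linarith [hx.1]))
  intro δ hδ
  have hmax : max c (s - δ) < s := max_lt hs.1 (by linarith)
  have hmid : (max c (s - δ) + s) / 2 ∈ Ioo (max c (s - δ)) s := ⟨by linarith, by linarith⟩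
  have hmem : (max c (s - δ) + s) / 2 ∈ Ioo c d :=
    ⟨by linarith [le_max_left c (s - δ)], by linarith [hs.2]⟩
  obtain ⟨y, hy1, hy2⟩ := mem_closure_iff.1 (hcl ⟨hsub hmem, hmem⟩) _ isOpen_Ioo hmid
  refine ⟨y, ⟨by linarith [le_max_right c (s - δ), hy1.1], hy1.2⟩, fun z hz => hy2.2 z ⟨?_, ?_⟩⟩
  · linarith [hz.1, min_le_right (b - x) (x - (b - r))]
  · linarith [hz.2, min_le_left (b - x) (x - (b - r))]

lemma portion {b p ε β : ℝ} {v : ℝ × ℝ → ℝ} (hv : SupS b p ε β v)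
    (hp : 2 ≤ p) (hε : 0 < ε) (hβ : 0 < β) {c d r M t0 : ℝ} (hc : 0 ≤ c) (hr : 0 < r) (hrb : r ≤ b)
    (hv0 : ∀ x ∈ Ioo (b - r) b, ∀ t ∈ Ioo c d, 0 ≤ v (x, t)) (hM : 0 < M)
    (ht0 : t0 ∈ Ioo c d) (hnLB : ¬ LB b v t0 M) :
    ∃ q : ℚ × ℚ, (∃ t ∈ Ioo (q.1 : ℝ) q.2, ¬ LB b v t M) ∧
      ∀ M' < M, ∀ t ∈ Ioo (q.1 : ℝ) q.2, LB b v t M' := by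
  set K := Ioo c d ∩ {t | LB b v t M}ᶜ with hK
  obtain ⟨n, c1, d1, ⟨ts, htsK, hts⟩, hsub, hcl⟩ := baire_portion (K := K) (U := Ioo c d)
    (isOpen_Ioo.isLocallyClosed.inter (LB_open b v M).isClosed_compl.isLocallyClosed)
    ⟨t0, ht0, hnLB⟩ isOpen_Ioo inter_subset_left (AA b v M)
    (fun t ht => AA_cov hv M (lt_of_le_of_lt hc ht.1.1))
  -- a good starting time
  obtain ⟨τ0, r1, hr1, hτ0, hτv⟩ : ∃ τ0 r1 : ℝ, 0 < r1 ∧ τ0 ∈ Ioo c1 ts ∧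
      ∀ x ∈ Ioo (b - r1) b, M ≤ v (x, τ0) := by
    by_cases h : ∃ τ ∈ AA b v M n, τ ∈ Ioo c1 ts
    · obtain ⟨τ, h1, h2⟩ := h
      exact ⟨τ, 1 / ((n : ℝ) + 1), by positivity, h2, h1⟩
    · have hmid : (c1 + ts) / 2 ∈ Ioo c1 ts := ⟨by linarith [hts.1], by linarith [hts.1]⟩
      have hmid' : (c1 + ts) / 2 ∈ Ioo c1 d1 := ⟨hmid.1, hmid.2.trans hts.2⟩
      have : LB b v ((c1 + ts) / 2) M := by
        by_contra hL
        obtain ⟨y, hy1, hy2⟩ := mem_closure_iff.1 (hcl ⟨⟨hsub hmid', hL⟩, hmid'⟩) _ isOpen_Ioo hmid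
        exact h ⟨y, hy2.2, hy1⟩
      obtain ⟨ρ, hρ, hh⟩ := this
      exact ⟨_, ρ, hρ, hmid, fun x hx => hh x hx _ ⟨by linarith, by linarith⟩⟩
  have hn0 : (0 : ℝ) < 1 / ((n : ℝ) + 1) := by positivity
  obtain ⟨r2, hr2, k1, k2, k3⟩ : ∃ r2 > 0, r2 ≤ r ∧ r2 ≤ r1 ∧ r2 ≤ 1 / ((n : ℝ) + 1) :=
    ⟨min r (min r1 (1 / ((n : ℝ) + 1))), by positivity, min_le_left _ _,
      (min_le_right _ _).trans (min_le_left _ _), (min_le_right _ _).trans (min_le_right _ _)⟩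
  have hcc1 : 0 ≤ c1 := by
    by_contra h
    push Not at h
    have h3 : 0 < ts := lt_of_le_of_lt hc htsK.1.1
    have := (hsub (show (0 : ℝ) ∈ Ioo c1 d1 from ⟨h, h3.trans hts.2⟩)).1
    linarith
  have key := keyJ hv hp hε hβ (r := r2) (M := M) (m0 := 0) (c := c1) (d := d1) (τ0 := τ0)
    hr2 (by linarith) hcc1 hM
    (fun x hx t ht => hv0 x ⟨by linarith [hx.1], hx.2⟩ t (hsub ht))
    (insert τ0 (AA b v M n))
    (by
      rintro τ (rfl | h) x hx
      · exact hτv x ⟨by linarith [hx.1], hx.2⟩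
      · exact h x ⟨by linarith [hx.1], hx.2⟩)
    (mem_insert _ _) hτ0.1
    (by
      intro t ht
      by_cases hL : LB b v t M
      · exact Or.inr hL
      · left
        refine closure_mono ?_ (hcl ⟨⟨hsub ht, hL⟩, ht⟩)
        exact inter_subset_right.trans (subset_insert _ _))
  obtain ⟨q1, hq1, hq1'⟩ := exists_rat_btwn hτ0.2
  obtain ⟨q2, hq2, hq2'⟩ := exists_rat_btwn hts.2
  refine ⟨(q1, q2), ⟨ts, ⟨hq1', hq2⟩, htsK.2⟩, ?_⟩
  intro M' hM' t ht
  simp only at ht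
  have hK0 : 0 < (M - 0) / r2 := by rw [sub_zero]; positivity
  set Kc := (M - 0) / r2
  set ρ := min (min r2 ((M - M') / Kc)) (min (t - τ0) (d1 - t)) with hρ
  have j1 : ρ ≤ r2 := (min_le_left _ _).trans (min_le_left _ _)
  have j2 : ρ ≤ (M - M') / Kc := (min_le_left _ _).trans (min_le_right _ _)
  have j3 : ρ ≤ t - τ0 := (min_le_right _ _).trans (min_le_left _ _)
  have j4 : ρ ≤ d1 - t := (min_le_right _ _).trans (min_le_right _ _)
  refine ⟨ρ, ?_, ?_⟩
  · have : 0 < M - M' := by linarith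
    exact lt_min (lt_min hr2 (by positivity))
      (lt_min (by linarith [ht.1]) (by linarith [ht.2]))
  · intro x hx s hs
    have := key s ⟨by linarith [hs.1], by linarith [hs.2]⟩ x ⟨by linarith [hx.1], hx.2⟩
    rw [le_div_iff₀ hK0] at j2
    have : Kc * (b - x) ≤ Kc * ρ := mul_le_mul_of_nonneg_left (by linarith [hx.1]) hK0.le
    linarith

lemma allLB {b p ε β : ℝ} {v : ℝ × ℝ → ℝ} (hv : SupS b p ε β v)
    (hp : 2 ≤ p) (hε : 0 < ε) (hβ : 0 < β) {c d r : ℝ} (hc : 0 ≤ c) (hr : 0 < r) (hrb : r ≤ b)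
    (hv0 : ∀ x ∈ Ioo (b - r) b, ∀ t ∈ Ioo c d, 0 ≤ v (x, t)) :
    ∀ t ∈ Ioo c d, ∀ M, LB b v t M := by
  intro t ht M
  by_contra hL
  have h : ∀ s : ℝ, ∃ q : ℚ × ℚ, (∃ t ∈ Ioo (q.1 : ℝ) q.2, ¬ LB b v t (|M| + Real.exp s)) ∧
      ∀ M' < |M| + Real.exp s, ∀ t ∈ Ioo (q.1 : ℝ) q.2, LB b v t M' := by
    intro s
    have h1 := Real.exp_pos s
    have h2 := le_abs_self M
    exact portion hv hp hε hβ hc hr hrb hv0 (by positivity) ht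
      (fun h => hL (h.mono (by linarith)))
  choose q hq1 hq2 using h
  have hlt : ∀ s s' : ℝ, s < s' → q s ≠ q s' := by
    intro s s' hss heq
    obtain ⟨t, ht, hn⟩ := hq1 s
    rw [heq] at ht
    exact hn (hq2 s' _ (by have := Real.exp_lt_exp.2 hss; linarith) t ht)
  have hinj : Function.Injective q := by
    intro s s' h
    rcases lt_trichotomy s s' with h1 | h1 | h1
    · exact absurd h (hlt _ _ h1)
    · exact h1
    · exact absurd h.symm (hlt _ _ h1)
  exact not_countable (α := ℝ) hinj.countable

lemma final {b p ε β : ℝ} {v : ℝ × ℝ → ℝ} (hb : 0 < b) (hv : SupS b p ε β v)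
    (hp : 2 ≤ p) (hε : 0 < ε) (hβ : 1 / (p - 1) ≤ β) : False := by
  have hp1 : 0 < p - 1 := by linarith
  have hβ0 : 0 < β := lt_of_lt_of_le (by positivity) hβ
  have hd1 : 1 ≤ (p - 1) * β := by rw [div_le_iff₀ hp1] at hβ; linarith
  obtain ⟨c, d, r, hc, hcd, hr, hrb, hr2, hv0⟩ := first hb hv hp hε hβ0
  have hLB := allLB hv hp hε hβ0 hc hr hrb hv0
  obtain ⟨s, T, hs, hsT, hT⟩ : ∃ s T : ℝ, c < s ∧ s < T ∧ T < d :=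
    ⟨(2 * c + d) / 3, (c + 2 * d) / 3, by linarith, by linarith, by linarith⟩
  have hTs : 0 < T - s := by linarith
  obtain ⟨k, hk, hk1, hk2⟩ : ∃ k > 0, k * (T - s) ≤ r ∧ k ≤ 1 / 2 := by
    refine ⟨min (r / (T - s)) (1 / 2), by positivity, ?_, min_le_right _ _⟩
    rw [← le_div_iff₀ hTs]; exact min_le_left _ _
  have main : ∀ B : ℝ, 1 ≤ B → B * (k * (T - s) / 2) ≤
      v (b - k * (T - s) / 4, (s + T) / 2) := by
    intro B hB
    have hks : 0 < k * (T - s) := by positivity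
    set W : ℝ × ℝ → ℝ := fun q => B * ((1 + (q.1 - b + k * (q.2 - s))) ^ 2 - 1) with hW
    have hWC : ContDiff ℝ 2 W := by simp only [hW]; fun_prop
    have hWc := hWC.continuous
    have hcmp := comp hv (x1 := b - r) (x2 := b) (s := s) (T := T) (by linarith) le_rfl
      (by linarith) W (fun x t => 2 * B * k * (1 + (x - b + k * (t - s))))
      (fun x t => 2 * B * (1 + (x - b + k * (t - s)))) (fun _ _ => 2 * B) hWC ?_ ?_ ?_ ?_ ?_
      (b - k * (T - s) / 4) ⟨by linarith, by linarith⟩ ((s + T) / 2)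
      ⟨by linarith, by linarith⟩
    · refine le_trans ?_ hcmp
      simp only [hW]
      have : b - k * (T - s) / 4 - b + k * ((s + T) / 2 - s) = k * (T - s) / 4 := by ring
      rw [this]
      apply mul_le_mul_of_nonneg_left _ (by linarith)
      nlinarith
    · intro x t
      have a0 := ((((((hasDerivAt_id t).sub_const s).const_mul k).const_add (x - b)).const_add
        1).pow 2).sub_const 1
      exact (a0.const_mul B).congr_deriv (by simp; ring)
    · intro x t
      have a0 := ((((((hasDerivAt_id x).sub_const b).add_const (k * (t - s)))).const_add
        1).pow 2).sub_const 1
      exact (a0.const_mul B).congr_deriv (by simp; ring)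
    · intro x t
      have a0 := ((((hasDerivAt_id x).sub_const b).add_const (k * (t - s)))).const_add 1
      exact (a0.const_mul (2 * B)).congr_deriv (by simp)
    · intro x hx t ht hlt
      have hv' := hv0 x hx t ⟨by linarith [ht.1], by linarith [ht.2]⟩
      have hWp : 0 < W (x, t) := by linarith
      simp only [hW] at hWp
      set ξ := x - b + k * (t - s) with hξ
      have hkt : 0 ≤ k * (t - s) := mul_nonneg hk.le (by linarith [ht.1])
      have hkt2 : k * (t - s) ≤ k * (T - s) :=
        mul_le_mul_of_nonneg_left (by linarith [ht.2]) hk.le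
      have hξ1 : -(1 / 2) ≤ ξ := by simp only [hξ]; linarith [hx.1]
      have hξ2 : ξ ≤ 1 := by simp only [hξ]; linarith [hx.2]
      have hξ0 : 0 < ξ := by
        by_contra hneg
        push Not at hneg
        have : (1 + ξ) ^ 2 - 1 ≤ 0 := by nlinarith
        have := mul_nonpos_of_nonneg_of_nonpos (show 0 ≤ B by linarith) this
        linarith
      have hab : 2 * B ≤ |2 * B * (1 + ξ)| := by
        rw [abs_of_pos (by positivity)]; nlinarith
      refine le_trans ?_ (HH_lower hp hε hβ0 (a0 := 2 * B) (z := 2 * B) (by positivity) hab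
        (by positivity))
      have e2 : (2 * B) ^ (p - 2) * (2 * B) = (2 * B) ^ (p - 1) := by
        rw [← Real.rpow_add_one (by positivity)]; congr 1; ring
      rw [e2, ← Real.rpow_mul (by positivity)]
      calc 2 * B * k * (1 + ξ) = 2 * B * (k * (1 + ξ)) := by ring
        _ ≤ 2 * B * 1 := by gcongr; nlinarith
        _ = (2 * B) ^ (1 : ℝ) := by simp
        _ ≤ _ := Real.rpow_le_rpow_of_exponent_le (by linarith) hd1
    · intro x hx t ht hor η hη
      by_cases hxb : x = b
      · subst hxb
        have := bd_of_bound (v := v) (q := (x, t)) (c := W (x, t)) (P := fun q => q.1 < x) hWc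
          le_rfl (hLB t ⟨by linarith [ht.1], by linarith [ht.2]⟩ _).ev η hη
        filter_upwards [this] with y hy a1 a2 using hy a1.2
      · have hkt : 0 ≤ k * (t - s) := mul_nonneg hk.le (by linarith [ht.1])
        have hkt2 : k * (t - s) ≤ k * (T - s) :=
          mul_le_mul_of_nonneg_left (by linarith [ht.2]) hk.le
        have hneg : x - b + k * (t - s) ≤ 0 := by
          rcases hor with h | h | h
          · rw [h]; linarith
          · exact absurd h hxb
          · rw [h]; simp; linarith [hx.2]
        have := bd_of_bound (v := v) (q := (x, t)) (c := 0)
          (P := fun q => q.1 ∈ Ioo (b - r) b ∧ q.2 ∈ Ioo s T) hWc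
          (by
            simp only [hW]
            apply mul_nonpos_of_nonneg_of_nonpos (by linarith)
            have : -(1 / 2) ≤ x - b + k * (t - s) := by linarith [hx.1]
            nlinarith)
          (Eventually.of_forall fun y hy => hv0 y.1 hy.1 y.2
            ⟨by linarith [hy.2.1], by linarith [hy.2.2]⟩) η hη
        filter_upwards [this] with y hy a1 a2 using hy ⟨a1, a2⟩
  have hks : 0 < k * (T - s) / 2 := by positivity
  set V := v (b - k * (T - s) / 4, (s + T) / 2)
  have := main ((|V| + 1) / (k * (T - s) / 2) + 1) (by
    have : 0 ≤ (|V| + 1) / (k * (T - s) / 2) := by positivity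
    linarith)
  rw [add_mul, div_mul_cancel₀ _ hks.ne'] at this
  linarith [le_abs_self V]

/-- non-existence for the `p`-Laplace type heat equation when
`β₁ ≥ 1/(p-1)` and `u₀` is bounded from below. -/
theorem pLaplace_nonexistence (b p ε β1 : ℝ) (u0 : ℝ → ℝ)
    (hb : 0 < b) (hp : 2 ≤ p) (hε : 0 < ε) (hβ1 : 1 / (p - 1) ≤ β1)
    (hu0c : ContinuousOn u0 (Ioo (-b) b))
    (hu0b : ∃ m : ℝ, ∀ x ∈ Ioo (-b) b, m ≤ u0 x) :
    ¬ ∃ u : ℝ × ℝ → ℝ,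
      IsVSol b (fun s => |s| ^ (β1 - 1) * s)
        (fun s => (p - 1) * |s| ^ (p - 2) + ε) u0 u := by
  rintro ⟨u, -, ⟨hlsc, hvisc, hbc⟩, -⟩
  refine final (p := p) (ε := ε) (β := β1) (v := lscEnv b u) hb ⟨?_, ?_, ?_⟩ hp hε hβ1
  · intro q hq y hy
    have hsub : Qset b ⊆ Q0set b := fun z hz => ⟨hz.1, le_of_lt (show (0 : ℝ) < z.2 from hz.2)⟩
    have := hlsc q (hsub hq) y hy
    rwa [nhdsWithin_eq_nhds.2 (Filter.mem_of_superset ((isOpen_Qset b).mem_nhds hq) hsub)] at this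
  · intro φ hφ q hq hmin
    have := hvisc φ hφ.contDiffOn q hq (hmin.on _)
    simp only [HH]
    linarith
  · intro t ht
    exact (hbc t ht).1
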